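/- arXiv:2409.04456 — 2 statements merged into one kernel-verified Lean document; each statement's English description precedes it below -/
import Mathlib

section
/- Given a bin packing instance with capacity B, sizes s_t and demands q_t (t = 1,…,T), every packing into k bins induces a finitely supported function z : 𝕡 → ℕ on the set 𝕡 of feasible patterns such that ∑_{p∈𝕡} z(p) = k and ∑_{p∈𝕡} p_t · z(p) ≥ q_t for every item type t. Consequently, the optimal value of the pattern-based covering formulation is at most the minimum number of bins. -/
/-- `x` is a packing of the demands `q` (with item sizes `s` and bin capacity `B`)
into `k` bins: bin `j` contains `x t j` items of type `t`, all demands are met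
exactly and no bin load exceeds `B`. -/
def IsPacking (T B : ℕ) (s q : Fin T → ℕ) (k : ℕ) (x : Fin T → Fin k → ℕ) : Prop :=
  (∀ t, ∑ j, x t j = q t) ∧ ∀ j, ∑ t, s t * x t j ≤ B

/-- `p` is a feasible pattern: a vector of item-type multiplicities fitting in
one bin of capacity `B`. -/
def IsPattern (T B : ℕ) (s : Fin T → ℕ) (p : Fin T → ℕ) : Prop :=
  ∑ t, s t * p t ≤ B

/-- `z` is a feasible solution of the pattern-based covering formulation:
a finitely supported choice of multiplicities of feasible patterns covering
all the demands. -/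
def IsCover (T B : ℕ) (s q : Fin T → ℕ) (z : (Fin T → ℕ) →₀ ℕ) : Prop :=
  (∀ p ∈ z.support, IsPattern T B s p) ∧ ∀ t, q t ≤ ∑ p ∈ z.support, p t * z p

/-- Summing a weight against the multiplicities of a finite family amounts to summing the weight
over the family. -/
lemma sum_support_sum_single_one {ι α : Type*} [Fintype ι] (g : ι → α) (f : α → ℕ) :
    ∑ a ∈ (∑ i, Finsupp.single (g i) 1 : α →₀ ℕ).support,
      f a * (∑ i, Finsupp.single (g i) 1 : α →₀ ℕ) a = ∑ i, f (g i) := by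
  classical
  change (∑ i, Finsupp.single (g i) 1 : α →₀ ℕ).sum (fun a n => f a * n) = _
  rw [← Finsupp.sum_finsetSum_index (fun _ => mul_zero _) (fun _ _ _ => mul_add _ _ _)]
  simp

/-- The patterns of the bins of a packing form a cover with as many patterns as bins. -/
lemma IsPacking.exists_isCover {T B : ℕ} {s q : Fin T → ℕ} {k : ℕ} {x : Fin T → Fin k → ℕ}
    (hx : IsPacking T B s q k x) :
    ∃ z : (Fin T → ℕ) →₀ ℕ, IsCover T B s q z ∧ ∑ p ∈ z.support, z p = k := by
  classical
  refine ⟨∑ j, Finsupp.single (fun t => x t j) 1, ⟨fun p hp => ?_, fun t => ?_⟩, ?_⟩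
  · obtain ⟨j, -, hj⟩ := Finset.mem_biUnion.1 (Finsupp.support_finsetSum hp)
    obtain rfl := Finset.mem_singleton.1 (Finsupp.support_single_subset hj)
    exact hx.2 j
  · rw [sum_support_sum_single_one (fun j t => x t j) (fun p => p t), hx.1 t]
  · simpa using sum_support_sum_single_one (fun j t => x t j) (fun _ => 1)

/-- If every item fits in a bin, putting each item in its own bin is a packing. -/
lemma exists_isPacking {T B : ℕ} {s : Fin T → ℕ} (q : Fin T → ℕ) (hs : ∀ t, s t ≤ B) :
    ∃ (k : ℕ) (x : Fin T → Fin k → ℕ), IsPacking T B s q k x := by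
  let e := Fintype.equivFin (Σ t, Fin (q t))
  refine ⟨_, fun t j => if (e.symm j).1 = t then 1 else 0, fun t => ?_, fun j => ?_⟩
  · rw [e.symm.sum_comp (fun i => if i.1 = t then 1 else 0), Fintype.sum_sigma]
    simp [apply_ite Finset.card]
  · simpa using hs _

/-- Every packing into `k` bins induces a finitely supported feasible solution of
the pattern-based covering formulation of objective value `k`; consequently the
optimal value of the covering formulation is at most the minimum number of bins. -/
theorem packing_induces_cover (T B : ℕ) (hB : 0 < B) (s q : Fin T → ℕ)
    (hs : ∀ t, 0 < s t ∧ s t ≤ B) :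
    (∀ (k : ℕ) (x : Fin T → Fin k → ℕ), IsPacking T B s q k x →
      ∃ z : (Fin T → ℕ) →₀ ℕ, IsCover T B s q z ∧ ∑ p ∈ z.support, z p = k) ∧
    sInf {n | ∃ z : (Fin T → ℕ) →₀ ℕ, IsCover T B s q z ∧ ∑ p ∈ z.support, z p = n} ≤
      sInf {k | ∃ x : Fin T → Fin k → ℕ, IsPacking T B s q k x} := by
  refine ⟨fun k x hx => hx.exists_isCover, Nat.sInf_le ?_⟩
  obtain ⟨x, hx⟩ := Nat.sInf_mem
    (s := {k | ∃ x : Fin T → Fin k → ℕ, IsPacking T B s q k x})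
    (exists_isPacking q fun t => (hs t).2)
  exact hx.exists_isCover
end

section
/- Given a bin packing instance with capacity B, sizes s_t and demands q_t (t = 1,…,T), every finitely supported function z : 𝕡 → ℕ on the set 𝕡 of feasible patterns satisfying the covering constraints ∑_{p∈𝕡} p_t · z(p) ≥ q_t for all t yields a packing of all demanded items into ∑_{p∈𝕡} z(p) bins: one can choose x_{t,j} ≤ p^{(j)}_t for each of the ∑ z(p) bins j (where p^{(j)} is the pattern assigned to bin j, repeated z(p) times) so that ∑_j x_{t,j} = q_t for every t and each bin's load is at most B. Consequently, the minimum number of bins is at most the optimal value of the pattern-based covering formulation. -/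
/-- A natural number below a finite sum splits into parts bounded by the summands. -/
theorem exists_le_sum_eq_of_le_sum {ι : Type*} [DecidableEq ι] (A : Finset ι) (f : ι → ℕ)
    (n : ℕ) (h : n ≤ ∑ i ∈ A, f i) : ∃ g : ι → ℕ, g ≤ f ∧ ∑ i ∈ A, g i = n := by
  induction A using Finset.induction_on generalizing n with
  | empty => exact ⟨0, fun _ => Nat.zero_le _, by simpa [eq_comm] using h⟩
  | insert a A ha ih =>
    rw [Finset.sum_insert ha] at h
    obtain ⟨g, hg, hsum⟩ := ih (n - min n (f a)) (by omega)
    refine ⟨Function.update g a (min n (f a)), fun i => ?_, ?_⟩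
    · obtain rfl | hi := eq_or_ne i a
      · simp
      · simpa [hi] using hg i
    · rw [Finset.sum_insert ha, Finset.sum_update_of_notMem ha, Function.update_self, hsum]
      omega

/-- The elements of a finitely supported multiset can be listed with their multiplicities. -/
theorem Finsupp.exists_enumeration {α : Type*} (z : α →₀ ℕ) :
    ∃ e : Fin (∑ a ∈ z.support, z a) → α, (∀ j, e j ∈ z.support) ∧
      ∀ f : α → ℕ, ∑ j, f (e j) = ∑ a ∈ z.support, f a * z a := by
  have hcard : Fintype.card (Σ a : z.support, Fin (z a)) = ∑ a ∈ z.support, z a := by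
    simp [Finset.sum_attach z.support z]
  let φ := (Fintype.equivFinOfCardEq hcard).symm
  refine ⟨fun j => (φ j).1, fun j => (φ j).1.2, fun f => ?_⟩
  rw [φ.sum_comp (fun y => f y.1), Fintype.sum_sigma,
    ← Finset.sum_coe_sort z.support fun a => f a * z a]
  simp [mul_comm]

theorem IsCover.exists_packing {T B : ℕ} {s q : Fin T → ℕ} {z : (Fin T → ℕ) →₀ ℕ}
    (hz : IsCover T B s q z) :
    ∃ (pat : Fin (∑ p ∈ z.support, z p) → (Fin T → ℕ))
      (x : Fin T → Fin (∑ p ∈ z.support, z p) → ℕ),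
      (∀ p : Fin T → ℕ, (Finset.univ.filter (fun j => pat j = p)).card = z p) ∧
      (∀ t j, x t j ≤ pat j t) ∧
      IsPacking T B s q (∑ p ∈ z.support, z p) x := by
  obtain ⟨pat, hmem, hsum⟩ := z.exists_enumeration
  have hx (t : Fin T) := exists_le_sum_eq_of_le_sum Finset.univ (fun j => pat j t) (q t)
    ((hz.2 t).trans_eq (hsum fun p => p t).symm)
  choose x hle hxq using hx
  refine ⟨pat, x, fun p => ?_, fun t j => hle t j, hxq, fun j => ?_⟩
  · rw [Finset.card_filter, hsum fun p' => if p' = p then 1 else 0]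
    simp +contextual [eq_comm]
  · exact (Finset.sum_le_sum fun t _ => Nat.mul_le_mul_left _ (hle t j)).trans
      (hz.1 _ (hmem j))

/-- Packing every item in a bin of its own gives a cover. -/
theorem exists_isCover {T B : ℕ} {s : Fin T → ℕ} (q : Fin T → ℕ) (hs : ∀ t, s t ≤ B) :
    ∃ z, IsCover T B s q z := by
  refine ⟨∑ t, Finsupp.single (Pi.single t 1) (q t), fun p hp => ?_, fun t => ?_⟩
  · obtain ⟨t, -, ht⟩ := Finset.mem_biUnion.1 (Finsupp.support_finsetSum hp)
    obtain rfl := Finset.mem_singleton.1 (Finsupp.support_single_subset ht)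
    simpa [IsPattern, Pi.single_apply] using hs t
  · change q t ≤ Finsupp.sum _ fun (p : Fin T → ℕ) n => p t * n
    rw [← Finsupp.sum_finsetSum_index (by simp) (by intros; ring)]
    simp [Pi.single_apply]

/-- Every feasible solution `z` of the pattern-based covering formulation yields a
packing of all demanded items into `∑ₚ z(p)` bins: each bin `j` is assigned a pattern
`pat j` (each pattern `p` being used exactly `z p` times) and packed with `x t j ≤
pat j t` items of each type so that all demands are met exactly and every bin load is
at most `B`. Consequently the minimum number of bins is at most the optimal value of
the covering formulation. -/
theorem cover_induces_packing (T B : ℕ) (hB : 0 < B) (s q : Fin T → ℕ)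
    (hs : ∀ t, 0 < s t ∧ s t ≤ B) :
    (∀ z : (Fin T → ℕ) →₀ ℕ, IsCover T B s q z →
      ∃ (pat : Fin (∑ p ∈ z.support, z p) → (Fin T → ℕ))
        (x : Fin T → Fin (∑ p ∈ z.support, z p) → ℕ),
        (∀ p : Fin T → ℕ, (Finset.univ.filter (fun j => pat j = p)).card = z p) ∧
        (∀ t j, x t j ≤ pat j t) ∧
        IsPacking T B s q (∑ p ∈ z.support, z p) x) ∧
    sInf {k | ∃ x : Fin T → Fin k → ℕ, IsPacking T B s q k x} ≤
      sInf {n | ∃ z : (Fin T → ℕ) →₀ ℕ, IsCover T B s q z ∧ ∑ p ∈ z.support, z p = n} := by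
  refine ⟨fun z hz => hz.exists_packing, ?_⟩
  obtain ⟨z₀, hz₀⟩ := exists_isCover q fun t => (hs t).2
  refine le_csInf ⟨_, z₀, hz₀, rfl⟩ ?_
  rintro _ ⟨z, hz, rfl⟩
  obtain ⟨-, x, -, -, hx⟩ := hz.exists_packing
  exact Nat.sInf_le ⟨x, hx⟩
end
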